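/- There exists a locally finite connected graph G with the following property: if (T, (V_t)) is a rooted tree-decomposition of G such that every end ω of G gives rise to a rooted ray R_ω of T with liminf_{e∈E(R_ω)} V_e = ∅ and liminf_{e∈E(R_ω)} |V_e| = deg(ω), then (T, (V_t)) is not strongly linked. -/

import Mathlib

open SimpleGraph

universe u v

section CommonDefs

variable {V : Type u} {N : Type v}

/-- `u` and `w` are joined by a walk in `G` all of whose vertices avoid `X`,
i.e. they lie in the same component of `G - X`. -/
def ConnAvoiding (G : SimpleGraph V) (X : Set V) (u w : V) : Prop :=
  ∃ p : G.Walk u w, ∀ x ∈ p.support, x ∉ X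

/-- `r` is a (one-way infinite) ray in `G`. -/
def IsRay (G : SimpleGraph V) (r : ℕ → V) : Prop :=
  Function.Injective r ∧ ∀ n : ℕ, G.Adj (r n) (r (n + 1))

/-- Two rays are equivalent (i.e. belong to the same end) if for every finite vertex set `X`
they have tails in the same component of `G - X`. -/
def RayEquiv (G : SimpleGraph V) (r r' : ℕ → V) : Prop :=
  ∀ X : Set V, X.Finite → ∃ M : ℕ, ∀ m ≥ M, ∀ n ≥ M, ConnAvoiding G X (r m) (r' n)

/-- `v` lies in the component `C_G(X, ε)` of `G - X` containing a tail of the ray `r`. -/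
def InEndComp (G : SimpleGraph V) (X : Set V) (r : ℕ → V) (v : V) : Prop :=
  ∃ M : ℕ, ∀ n ≥ M, ConnAvoiding G X v (r n)

/-- `v` dominates the end of the ray `r`. -/
def Dominates (G : SimpleGraph V) (r : ℕ → V) (v : V) : Prop :=
  ∀ X : Set V, X.Finite → v ∉ X → InEndComp G X r v

/-- `Dom(ε)` for the end `ε` of the ray `r`. -/
def DomSet (G : SimpleGraph V) (r : ℕ → V) : Set V := {v | Dominates G r v}

/-- There are `n` pairwise (vertex-)disjoint rays belonging to the end of `r`. -/
def HasDisjRays (G : SimpleGraph V) (r : ℕ → V) (n : ℕ) : Prop :=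
  ∃ f : Fin n → ℕ → V, (∀ i, IsRay G (f i)) ∧ (∀ i, RayEquiv G r (f i)) ∧
    Pairwise fun i j => ∀ k l : ℕ, f i k ≠ f j l

/-- The degree of the end of `r`, as an extended natural number. -/
noncomputable def EndDegree (G : SimpleGraph V) (r : ℕ → V) : ℕ∞ :=
  ⨆ (n : ℕ) (_ : HasDisjRays G r n), (n : ℕ∞)

/-- A family of pairwise disjoint `A`–`B` paths indexed by `ι`. -/
def DisjointPathsFam (G : SimpleGraph V) (A B : Set V) (ι : Type*) : Prop :=
  ∃ (a b : ι → V) (p : ∀ i : ι, G.Walk (a i) (b i)),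
    (∀ i, (p i).IsPath) ∧ (∀ i, a i ∈ A) ∧ (∀ i, b i ∈ B) ∧
    Pairwise fun i j => ∀ x ∈ (p i).support, x ∉ (p j).support

/-- There are `n` pairwise disjoint `A`–`B` paths in `G`. -/
def DisjointPaths (G : SimpleGraph V) (A B : Set V) (n : ℕ) : Prop :=
  DisjointPathsFam G A B (Fin n)

/-- `C` is (the vertex set of) a connected component of the subgraph of `G` induced on `S`. -/
def IsCompOf (G : SimpleGraph V) (S C : Set V) : Prop :=
  C.Nonempty ∧ C ⊆ S ∧ (G.induce C).Connected ∧
    ∀ u ∈ C, ∀ v ∈ S, G.Adj u v → v ∈ C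

/-- The neighbourhood `N_G(C)` of the set `C` in `G`. -/
def NbhdSet (G : SimpleGraph V) (C : Set V) : Set V :=
  {v | v ∉ C ∧ ∃ u ∈ C, G.Adj u v}

/-- A graph is locally finite if every vertex has finite degree. -/
def LocFin (G : SimpleGraph V) : Prop := ∀ v : V, {w : V | G.Adj v w}.Finite

/-- A tree-decomposition of `G` with decomposition tree `T`. -/
structure TreeDecomp (G : SimpleGraph V) (T : SimpleGraph N) : Type (max u v) where
  isTree : T.IsTree
  bag : N → Set V
  bag_cover : ∀ v : V, ∃ t : N, v ∈ bag t
  bag_edge : ∀ ⦃x y : V⦄, G.Adj x y → ∃ t : N, x ∈ bag t ∧ y ∈ bag t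
  bag_conn : ∀ (v : V) {s t : N} (p : T.Walk s t), p.IsPath →
    v ∈ bag s → v ∈ bag t → ∀ x ∈ p.support, v ∈ bag x

namespace TreeDecomp

variable {G : SimpleGraph V} {T : SimpleGraph N}

/-- The unique path in the tree `T` from `s` to `t`. -/
noncomputable def path (D : TreeDecomp G T) (s t : N) : T.Walk s t :=
  (D.isTree.existsUnique_path s t).choose

/-- The adhesion set of the edge `ab` of `T`. -/
def adh (D : TreeDecomp G T) (a b : N) : Set V := D.bag a ∩ D.bag b

/-- `ab` is an edge of `T` lying on the path from `s` to `t`. -/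
def EdgeOnPath (D : TreeDecomp G T) (s t a b : N) : Prop :=
  T.Adj a b ∧ s(a, b) ∈ (D.path s t).edges

/-- All bags are finite. -/
def FiniteParts (D : TreeDecomp G T) : Prop := ∀ t : N, (D.bag t).Finite

/-- The tree-decomposition is lean. -/
def IsLean (D : TreeDecomp G T) : Prop :=
  ∀ (s t : N) (Zs Zt : Finset V), ↑Zs ⊆ D.bag s → ↑Zt ⊆ D.bag t →
    Zs.card = Zt.card →
    DisjointPaths G ↑Zs ↑Zt Zs.card ∨
      ∃ a b : N, D.EdgeOnPath s t a b ∧ (D.adh a b).encard < (Zs.card : ℕ∞)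

/-- The tree-decomposition is strongly linked: for all nodes `s ≠ t` there are
`min {|V_e| : e ∈ E(sTt)}` pairwise disjoint `V_s`–`V_t` paths. -/
def StronglyLinked (D : TreeDecomp G T) : Prop :=
  ∀ s t : N, s ≠ t →
    ∃ c : Cardinal.{u},
      (∀ a b : N, D.EdgeOnPath s t a b → c ≤ Cardinal.mk ↥(D.adh a b)) ∧
      (∃ a b : N, D.EdgeOnPath s t a b ∧ c = Cardinal.mk ↥(D.adh a b)) ∧
      ∃ ι : Type u, Cardinal.mk ι = c ∧ DisjointPathsFam G (D.bag s) (D.bag t) ι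

/-- One side of the separation of `G` induced by the edge `ab` of `T`: the union of the
bags over all nodes in the component of `T - ab` containing `a`. -/
def sideSet (D : TreeDecomp G T) (a b : N) : Set V :=
  ⋃ x ∈ {x : N | b ∉ (D.path a x).support}, D.bag x

end TreeDecomp

/-- A rooted tree-decomposition. -/
structure RootedTreeDecomp (G : SimpleGraph V) (T : SimpleGraph N)
    extends TreeDecomp G T : Type (max u v) where
  root : N

namespace RootedTreeDecomp

variable {G : SimpleGraph V} {T : SimpleGraph N}

/-- The tree-order on `T` induced by the root: `s ≤ t` iff `s` lies on the path
from the root to `t`. -/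
def le (D : RootedTreeDecomp G T) (s t : N) : Prop :=
  s ∈ (D.toTreeDecomp.path D.root t).support

/-- `st` is an edge of `T` with `s < t` in the tree-order. -/
def IsOrientedEdge (D : RootedTreeDecomp G T) (s t : N) : Prop :=
  T.Adj s t ∧ D.le s t

/-- The vertex set of `G↑e` for the oriented edge `e = st`: the union of the bags over
all nodes of the component `T_e` of `T - e` not containing the root. -/
def above (D : RootedTreeDecomp G T) (t : N) : Set V :=
  ⋃ x ∈ {x : N | D.le t x}, D.bag x

/-- The vertex set of `G∘↑e` (the part strictly above `e`) for the oriented edge `e = st`. -/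
def strictAbove (D : RootedTreeDecomp G T) (s t : N) : Set V :=
  D.above t \ (D.bag s ∩ D.bag t)

/-- The rooted tree-decomposition is componental. -/
def Componental (D : RootedTreeDecomp G T) : Prop :=
  ∀ s t : N, D.IsOrientedEdge s t → (G.induce (D.strictAbove s t)).Connected

/-- The rooted tree-decomposition is tight. -/
def Tight (D : RootedTreeDecomp G T) : Prop :=
  ∀ s t : N, D.IsOrientedEdge s t →
    ∃ C : Set V, IsCompOf G (D.strictAbove s t) C ∧ NbhdSet G C = D.bag s ∩ D.bag t

/-- The rooted tree-decomposition is linked: for all comparable nodes `s < t` there are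
`min {|V_e| : e ∈ E(sTt)}` pairwise disjoint `V_s`–`V_t` paths. -/
def Linked (D : RootedTreeDecomp G T) : Prop :=
  ∀ s t : N, D.le s t → s ≠ t →
    ∃ c : Cardinal.{u},
      (∀ a b : N, D.toTreeDecomp.EdgeOnPath s t a b →
        c ≤ Cardinal.mk ↥(D.bag a ∩ D.bag b)) ∧
      (∃ a b : N, D.toTreeDecomp.EdgeOnPath s t a b ∧
        c = Cardinal.mk ↥(D.bag a ∩ D.bag b)) ∧
      ∃ ι : Type u, Cardinal.mk ι = c ∧ DisjointPathsFam G (D.bag s) (D.bag t) ι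

/-- A rooted ray of `T`, i.e. a ray starting at the root. -/
def IsRootedRay (D : RootedTreeDecomp G T) (ρ : ℕ → N) : Prop :=
  IsRay T ρ ∧ ρ 0 = D.root

/-- `liminf_{e ∈ E(R)} V_e`: the vertices lying in `V_e` for all but finitely many
edges `e` of the ray `R = ρ`. -/
def bagLiminf (D : RootedTreeDecomp G T) (ρ : ℕ → N) : Set V :=
  {v | ∃ M : ℕ, ∀ n ≥ M, v ∈ D.bag (ρ n) ∩ D.bag (ρ (n + 1))}

/-- `liminf_{e ∈ E(R)} |V_e|` for the ray `R = ρ`. -/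
noncomputable def adhLiminf (D : RootedTreeDecomp G T) (ρ : ℕ → N) : ℕ∞ :=
  Filter.liminf (fun n : ℕ => (D.bag (ρ n) ∩ D.bag (ρ (n + 1))).encard) Filter.atTop

/-- The end of the ray `r` of `G` gives rise to the rooted ray `ρ` of `T`: every ray
equivalent to `r` meets every bag along `ρ` only finitely often, and for every edge
`e = st` of `ρ` the component `C_G(V_s, ε)` is contained in `G∘↑e`. -/
def GivesRise (D : RootedTreeDecomp G T) (r : ℕ → V) (ρ : ℕ → N) : Prop :=
  D.IsRootedRay ρ ∧
  (∀ r' : ℕ → V, IsRay G r' → RayEquiv G r r' →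
    ∀ n : ℕ, {k : ℕ | r' k ∈ D.bag (ρ n)}.Finite) ∧
  (∀ (n : ℕ) (v : V), InEndComp G (D.bag (ρ n)) r v →
    v ∈ D.strictAbove (ρ n) (ρ (n + 1)))

end RootedTreeDecomp

/-- `{A, B}` is a separation of `G`. -/
def IsSeparation (G : SimpleGraph V) (A B : Set V) : Prop :=
  A ∪ B = Set.univ ∧ ∀ a ∈ A \ B, ∀ b ∈ B \ A, ¬ G.Adj a b

/-- The separation `{A, B}` separates the ends of `r` and `r'`: they live in components of
`G - (A ∩ B)` contained in different sides of `{A, B}`. -/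
def SepSeparatesEnds (G : SimpleGraph V) (A B : Set V) (r r' : ℕ → V) : Prop :=
  ((∀ v, InEndComp G (A ∩ B) r v → v ∈ A \ B) ∧
    (∀ v, InEndComp G (A ∩ B) r' v → v ∈ B \ A)) ∨
  ((∀ v, InEndComp G (A ∩ B) r v → v ∈ B \ A) ∧
    (∀ v, InEndComp G (A ∩ B) r' v → v ∈ A \ B))

/-- The separation `{A, B}` efficiently distinguishes the ends of `r` and `r'`. -/
def EffDistinguishes (G : SimpleGraph V) (A B : Set V) (r r' : ℕ → V) : Prop :=
  IsSeparation G A B ∧ SepSeparatesEnds G A B r r' ∧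
    ∀ A' B' : Set V, IsSeparation G A' B' → SepSeparatesEnds G A' B' r r' →
      (A ∩ B).encard ≤ (A' ∩ B').encard

/-- The tree-decomposition `D` distinguishes the ends of `r` and `r'` efficiently. -/
def TreeDecomp.EffDistinguishesEnds {G : SimpleGraph V} {T : SimpleGraph N}
    (D : TreeDecomp G T) (r r' : ℕ → V) : Prop :=
  ∃ a b : N, T.Adj a b ∧ EffDistinguishes G (D.sideSet a b) (D.sideSet b a) r r'

/-- `G` contains `H` as a minor. -/
def HasMinor {W : Type v} (G : SimpleGraph V) (H : SimpleGraph W) : Prop :=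
  ∃ B : W → Set V, (∀ h, (B h).Nonempty) ∧ (∀ h, (G.induce (B h)).Connected) ∧
    (Pairwise fun h h' => Disjoint (B h) (B h')) ∧
    ∀ ⦃h h'⦄, H.Adj h h' → ∃ u ∈ B h, ∃ w ∈ B h', G.Adj u w

/-- The half-grid: the graph on `ℕ × ℤ` in which `(i, j)` and `(i', j')` are adjacent
iff `|i - i'| + |j - j'| = 1`. -/
def halfGrid : SimpleGraph (ℕ × ℤ) :=
  SimpleGraph.fromRel fun p q =>
    ((p.1 : ℤ) - (q.1 : ℤ)).natAbs + (p.2 - q.2).natAbs = 1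

/-- The one-way infinite path on `ℕ`. -/
def natRayGraph : SimpleGraph ℕ :=
  SimpleGraph.fromRel fun m n => n = m + 1

/-- The path on `m` vertices. -/
def finPathGraph (m : ℕ) : SimpleGraph (Fin m) :=
  SimpleGraph.fromRel fun i j => (j : ℕ) = (i : ℕ) + 1

/-- The strong product of two graphs. -/
def strongProd {W : Type v} (G : SimpleGraph V) (H : SimpleGraph W) : SimpleGraph (V × W) :=
  SimpleGraph.fromRel fun x y =>
    (x.1 = y.1 ∨ G.Adj x.1 y.1) ∧ (x.2 = y.2 ∨ H.Adj x.2 y.2)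

end CommonDefs

section Walks

variable {V : Type u} {G : SimpleGraph V}

theorem ConnAvoiding.symm {X : Set V} {x y : V} (h : ConnAvoiding G X x y) :
    ConnAvoiding G X y x := by
  obtain ⟨p, hp⟩ := h
  exact ⟨p.reverse, by simpa using hp⟩

theorem ConnAvoiding.trans {X : Set V} {x y z : V} (h : ConnAvoiding G X x y)
    (h' : ConnAvoiding G X y z) : ConnAvoiding G X x z := by
  obtain ⟨p, hp⟩ := h
  obtain ⟨q, hq⟩ := h'
  refine ⟨p.append q, fun a ha => ?_⟩
  rcases (SimpleGraph.Walk.mem_support_append_iff p q).1 ha with h | h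
  exacts [hp a h, hq a h]

theorem ConnAvoiding.refl {X : Set V} {x : V} (h : x ∉ X) : ConnAvoiding G X x x :=
  ⟨.nil, by simpa using h⟩

theorem ConnAvoiding.of_adj {X : Set V} {x y : V} (h : G.Adj x y) (hx : x ∉ X) (hy : y ∉ X) :
    ConnAvoiding G X x y :=
  ⟨h.toWalk, by simp [hx, hy]⟩

theorem ConnAvoiding.right_notMem {X : Set V} {x y : V} (h : ConnAvoiding G X x y) : y ∉ X := by
  obtain ⟨p, hp⟩ := h
  exact hp _ p.end_mem_support

theorem ConnAvoiding.of_mem_support {X : Set V} {a b x y : V} (p : G.Walk a b)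
    (hp : ∀ z ∈ p.support, z ∉ X) (hx : x ∈ p.support) (hy : y ∈ p.support) :
    ConnAvoiding G X x y := by
  classical
  have key : ∀ w ∈ p.support, ConnAvoiding G X a w := fun w hw =>
    ⟨p.takeUntil w hw, fun z hz => hp z (p.support_takeUntil_subset_support hw hz)⟩
  exact (key x hx).symm.trans (key y hy)

/-- A walk avoiding `X` cannot leave a set all of whose outgoing edges end in `X`. -/
theorem ConnAvoiding.mem_of_closed {X C : Set V} {x y : V} (h : ConnAvoiding G X x y)
    (hC : ∀ a ∈ C, ∀ b, G.Adj a b → b ∉ X → a ∉ X → b ∈ C) (hx : x ∈ C) : y ∈ C := by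
  obtain ⟨p, hp⟩ := h
  by_contra hy
  obtain ⟨d, hd, h1, h2⟩ := p.exists_boundary_dart C hx hy
  exact h2 (hC _ h1 _ d.adj (hp _ (p.dart_snd_mem_support_of_mem_darts hd))
    (hp _ (p.dart_fst_mem_support_of_mem_darts hd)))

theorem connAvoiding_ray {X : Set V} {r : ℕ → V} (hr : IsRay G r) {M : ℕ}
    (hM : ∀ m ≥ M, r m ∉ X) {m n : ℕ} (hm : M ≤ m) (hn : M ≤ n) :
    ConnAvoiding G X (r m) (r n) := by
  have key : ∀ k, ConnAvoiding G X (r M) (r (M + k)) := by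
    intro k
    induction k with
    | zero => exact .refl (hM _ le_rfl)
    | succ k ih =>
      exact ih.trans (.of_adj (hr.2 _) (hM _ (by omega)) (hM _ (by omega)))
  obtain ⟨a, rfl⟩ := Nat.exists_eq_add_of_le hm
  obtain ⟨b, rfl⟩ := Nat.exists_eq_add_of_le hn
  exact (key a).symm.trans (key b)

theorem exists_forall_ge_notMem {X : Set V} {r : ℕ → V} (h : {k | r k ∈ X}.Finite) :
    ∃ M, ∀ m ≥ M, r m ∉ X := by
  obtain ⟨M, hM⟩ := h.bddAbove
  exact ⟨M + 1, fun m hm hX => by have := hM hX; omega⟩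

theorem IsRay.exists_forall_ge_notMem {X : Set V} {r : ℕ → V} (hr : IsRay G r) (hX : X.Finite) :
    ∃ M, ∀ m ≥ M, r m ∉ X :=
  _root_.exists_forall_ge_notMem (hX.preimage hr.1.injOn)

theorem RayEquiv.of_infinite_inter {r r' : ℕ → V} (hr : IsRay G r) (hr' : IsRay G r')
    (h : {k | r' k ∈ Set.range r}.Infinite) : RayEquiv G r r' := by
  intro X hX
  obtain ⟨M, hM⟩ := hr.exists_forall_ge_notMem hX
  obtain ⟨M', hM'⟩ := hr'.exists_forall_ge_notMem hX
  have hfin : {k | r' k ∈ r '' Set.Iio M}.Finite :=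
    ((Set.finite_Iio M).image r).preimage hr'.1.injOn
  obtain ⟨k, ⟨⟨j, hj⟩, hk⟩, hkM⟩ := (h.sdiff hfin).exists_gt M'
  have hjM : M ≤ j := by
    by_contra hlt
    exact hk ⟨j, not_le.1 hlt, hj⟩
  refine ⟨max M M', fun m hm n hn => ?_⟩
  refine (connAvoiding_ray hr hM (le_trans (le_max_left _ _) hm) hjM).trans ?_
  rw [hj]
  exact connAvoiding_ray hr' hM' hkM.le (le_trans (le_max_right _ _) hn)

theorem RayEquiv.refl {r : ℕ → V} (hr : IsRay G r) : RayEquiv G r r :=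
  .of_infinite_inter hr hr (by simpa using Set.infinite_univ)

theorem RayEquiv.of_adj {r r' : ℕ → V} (hr : IsRay G r) (hr' : IsRay G r')
    (h : ∀ j, r j = r' j ∨ G.Adj (r j) (r' j)) : RayEquiv G r r' := by
  intro X hX
  obtain ⟨M, hM⟩ := hr.exists_forall_ge_notMem hX
  obtain ⟨M', hM'⟩ := hr'.exists_forall_ge_notMem hX
  refine ⟨max M M', fun m hm n hn => ?_⟩
  refine (connAvoiding_ray hr hM (n := n) (by omega) (by omega)).trans ?_
  rcases h n with h | h
  · rw [h]
    exact .refl (hM' n (by omega))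
  · exact .of_adj h (hM n (by omega)) (hM' n (by omega))

end Walks

namespace TreeDecomp

variable {V : Type u} {N : Type v} {G : SimpleGraph V} {T : SimpleGraph N}

theorem path_isPath (D : TreeDecomp G T) (s t : N) : (D.path s t).IsPath :=
  (D.isTree.existsUnique_path s t).choose_spec.1

theorem eq_path (D : TreeDecomp G T) {s t : N} {p : T.Walk s t} (hp : p.IsPath) :
    p = D.path s t :=
  (D.isTree.existsUnique_path s t).choose_spec.2 p hp

theorem edges_path_subset (D : TreeDecomp G T) {s t : N} (p : T.Walk s t) :
    (D.path s t).edges ⊆ p.edges := by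
  classical
  rw [← D.eq_path p.bypass_isPath]
  exact p.edges_bypass_subset_edges

end TreeDecomp

namespace RootedTreeDecomp

variable {V : Type u} {N : Type v} {G : SimpleGraph V} {T : SimpleGraph N}
  (D : RootedTreeDecomp G T)

/-- The distance of a node of the decomposition tree from the root. -/
noncomputable def depth (t : N) : ℕ := (D.path D.root t).length

variable {D}

theorem le.refl (t : N) : D.le t t := SimpleGraph.Walk.end_mem_support _

theorem le.path_eq [DecidableEq N] {t x : N} (h : D.le t x) :
    D.path D.root t = (D.path D.root x).takeUntil t h :=
  (D.eq_path ((D.path_isPath _ _).takeUntil h)).symm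

theorem le.trans {s t x : N} (h : D.le s t) (h' : D.le t x) : D.le s x := by
  classical
  unfold le at h
  rw [h'.path_eq] at h
  exact SimpleGraph.Walk.support_takeUntil_subset_support _ _ h

theorem le.depth_le {t x : N} (h : D.le t x) : D.depth t ≤ D.depth x := by
  classical
  unfold depth
  rw [h.path_eq]
  exact SimpleGraph.Walk.length_takeUntil_le_length _ _

theorem le.eq_getVert {t x : N} (h : D.le t x) :
    t = (D.path D.root x).getVert (D.depth t) := by
  classical
  unfold depth
  rw [h.path_eq]
  exact (SimpleGraph.Walk.getVert_length_takeUntil _).symm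

theorem IsOrientedEdge.eq_of_adj {s t x y : N} (h : D.IsOrientedEdge s t) (hxy : T.Adj x y)
    (hx : D.le t x) (hy : ¬ D.le t y) : x = t ∧ y = s := by
  classical
  have hyx : y ∈ (D.path D.root x).support := by
    by_contra hn
    have := D.eq_path ((D.path_isPath D.root x).concat hn hxy)
    apply hy
    unfold le
    rw [← this, SimpleGraph.Walk.support_concat]
    simp only [List.mem_append]
    exact Or.inl hx
  have hxn : x ∉ (D.path D.root y).support := by
    rw [le.path_eq (D := D) hyx]
    exact SimpleGraph.Walk.endpoint_notMem_support_takeUntil (D.path_isPath _ _) hyx hxy.ne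
  have hcon := D.eq_path ((D.path_isPath D.root y).concat hxn hxy.symm)
  have htx : x = t := by
    unfold le at hx
    rw [← hcon, SimpleGraph.Walk.support_concat] at hx
    simp only [List.mem_append, List.mem_singleton] at hx
    rcases hx with hx | hx
    · exact absurd hx hy
    · exact hx.symm
  subst htx
  have hac := D.isTree.isAcyclic
  exact ⟨rfl, (hac.eq_penultimate_of_adj_end (D.path_isPath _ _) hxy hyx).trans
    (hac.eq_penultimate_of_adj_end (D.path_isPath _ _) h.1.symm h.2).symm⟩

theorem IsOrientedEdge.mem_adh {s t x y : N} {v : V} (h : D.IsOrientedEdge s t)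
    (hx : D.le t x) (hvx : v ∈ D.bag x) (hy : ¬ D.le t y) (hvy : v ∈ D.bag y) :
    v ∈ D.bag s ∩ D.bag t := by
  obtain ⟨d, hd, h1, h2⟩ := (D.path x y).exists_boundary_dart {z | D.le t z} hx hy
  obtain ⟨e1, e2⟩ := h.eq_of_adj d.adj h1 h2
  have hb := D.bag_conn v (D.path x y) (D.path_isPath x y) hvx hvy
  constructor
  · rw [← e2]
    exact hb _ ((D.path x y).dart_snd_mem_support_of_mem_darts hd)
  · rw [← e1]
    exact hb _ ((D.path x y).dart_fst_mem_support_of_mem_darts hd)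

theorem mem_above {t : N} {v : V} : v ∈ D.above t ↔ ∃ x, D.le t x ∧ v ∈ D.bag x := by
  simp [above]

theorem above_anti {s t : N} (h : D.le s t) : D.above t ⊆ D.above s := by
  intro v hv
  obtain ⟨x, hx, hvx⟩ := mem_above.1 hv
  exact mem_above.2 ⟨x, h.trans hx, hvx⟩

theorem IsOrientedEdge.mem_adh_of_adj {s t : N} {p q : V} (h : D.IsOrientedEdge s t)
    (hpq : G.Adj p q) (hp : p ∈ D.above t) (hq : q ∉ D.above t) : p ∈ D.bag s ∩ D.bag t := by
  obtain ⟨y, hpy, hqy⟩ := D.bag_edge hpq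
  obtain ⟨x, hx, hvx⟩ := mem_above.1 hp
  exact h.mem_adh hx hvx (fun hy => hq (mem_above.2 ⟨y, hy, hqy⟩)) hpy

theorem IsOrientedEdge.exists_mem_support {s t y : N} {a b : V} (h : D.IsOrientedEdge s t)
    (p : G.Walk a b) (ha : a ∈ D.above t) (hb : b ∈ D.bag y) (hy : ¬ D.le t y) :
    ∃ v ∈ p.support, v ∈ D.bag s ∩ D.bag t := by
  by_cases hbt : b ∈ D.above t
  · obtain ⟨x, hx, hvx⟩ := mem_above.1 hbt
    exact ⟨b, p.end_mem_support, h.mem_adh hx hvx hy hb⟩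
  · obtain ⟨d, hd, h1, h2⟩ := p.exists_boundary_dart _ ha hbt
    exact ⟨_, p.dart_fst_mem_support_of_mem_darts hd, h.mem_adh_of_adj d.adj h1 h2⟩

theorem IsRootedRay.exists_isPath {ρ : ℕ → N} (h : D.IsRootedRay ρ) (m l : ℕ) :
    ∃ p : T.Walk (ρ m) (ρ (m + l)), p.IsPath ∧ p.length = l ∧
      (∀ x, x ∈ p.support ↔ ∃ j, j ≤ l ∧ x = ρ (m + j)) ∧
      ∀ e ∈ p.edges, ∃ j, m ≤ j ∧ e = s(ρ j, ρ (j + 1)) := by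
  induction l with
  | zero => exact ⟨.nil, by simp, rfl, by simp, by simp⟩
  | succ l ih =>
    obtain ⟨p, hp, hl, hs, he⟩ := ih
    refine ⟨p.concat (h.1.2 (m + l)), hp.concat ?_ _, by simp [hl], fun x => ?_, fun e hem => ?_⟩
    · rw [hs]
      rintro ⟨j, hj, hj'⟩
      have := h.1.1 hj'
      omega
    · rw [SimpleGraph.Walk.support_concat]
      simp only [List.mem_append, List.mem_singleton, hs]
      constructor
      · rintro (⟨j, hj, rfl⟩ | rfl)
        exacts [⟨j, by omega, rfl⟩, ⟨l + 1, le_rfl, rfl⟩]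
      · rintro ⟨j, hj, rfl⟩
        rcases Nat.lt_or_ge l j with hlj | hlj
        · right
          rw [show j = l + 1 by omega]
        · exact Or.inl ⟨j, hlj, rfl⟩
    · rw [SimpleGraph.Walk.edges_concat] at hem
      simp only [List.concat_eq_append, List.mem_append, List.mem_singleton] at hem
      rcases hem with hem | hem
      · exact he e hem
      · exact ⟨m + l, by omega, hem⟩

theorem IsRootedRay.path_props {ρ : ℕ → N} (h : D.IsRootedRay ρ) (n : ℕ) :
    D.depth (ρ n) = n ∧ ∀ m ≤ n, D.le (ρ m) (ρ n) := by
  obtain ⟨p, hp, hl, hs, -⟩ := h.exists_isPath 0 n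
  have hq : p.copy h.2 (congrArg ρ (Nat.zero_add n)) = D.path D.root (ρ n) :=
    D.eq_path ((SimpleGraph.Walk.isPath_copy p _ _).2 hp)
  unfold depth le
  rw [← hq, SimpleGraph.Walk.length_copy, SimpleGraph.Walk.support_copy]
  exact ⟨hl, fun m hm => (hs _).2 ⟨m, hm, by rw [Nat.zero_add]⟩⟩

theorem IsRootedRay.le_of_le {ρ : ℕ → N} (h : D.IsRootedRay ρ) {m n : ℕ} (hmn : m ≤ n) :
    D.le (ρ m) (ρ n) :=
  (h.path_props n).2 m hmn

theorem IsRootedRay.isOrientedEdge {ρ : ℕ → N} (h : D.IsRootedRay ρ) (n : ℕ) :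
    D.IsOrientedEdge (ρ n) (ρ (n + 1)) :=
  ⟨h.1.2 n, h.le_of_le n.le_succ⟩

theorem IsRootedRay.eq_of_le {ρ ρ' : ℕ → N} (h : D.IsRootedRay ρ) (h' : D.IsRootedRay ρ')
    {n : ℕ} {x : N} (hx : D.le (ρ n) x) (hx' : D.le (ρ' n) x) : ρ n = ρ' n := by
  rw [hx.eq_getVert, hx'.eq_getVert, (h.path_props n).1, (h'.path_props n).1]

theorem IsRootedRay.ne_of_le {ρ ρ' : ℕ → N} (h : D.IsRootedRay ρ) (h' : D.IsRootedRay ρ')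
    {m n : ℕ} (hmn : m ≤ n) (hne : ρ m ≠ ρ' m) : ρ n ≠ ρ' n := fun heq =>
  hne (h.eq_of_le h' (h.le_of_le hmn) (heq ▸ h'.le_of_le hmn))

/-- Along a ray with empty `bagLiminf`, every vertex is eventually left behind. -/
theorem IsRootedRay.exists_notMem_above {ρ : ℕ → N} (h : D.IsRootedRay ρ)
    (hlim : D.bagLiminf ρ = ∅) (v : V) : ∃ J, ∀ j ≥ J, v ∉ D.above (ρ j) := by
  suffices ∃ J, v ∉ D.above (ρ J) by
    obtain ⟨J, hJ⟩ := this
    exact ⟨J, fun j hj hv => hJ (above_anti (h.le_of_le hj) hv)⟩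
  by_contra! hcon
  obtain ⟨x, hx⟩ := D.bag_cover v
  have : v ∈ D.bagLiminf ρ := by
    refine ⟨D.depth x, fun n hn => ?_⟩
    obtain ⟨y, hy, hvy⟩ := mem_above.1 (hcon (n + 1))
    refine (h.isOrientedEdge n).mem_adh hy hvy (fun hle => ?_) hx
    have := hle.depth_le
    rw [(h.path_props _).1] at this
    omega
  rw [hlim] at this
  exact this

theorem GivesRise.eventually_mem {r r' : ℕ → V} {ρ : ℕ → N} (h : D.GivesRise r ρ)
    (hr : IsRay G r) (hr' : IsRay G r') (hadj : ∀ j, r j = r' j ∨ G.Adj (r j) (r' j)) (n : ℕ) :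
    ∃ M, ∀ m ≥ M, r' m ∈ D.strictAbove (ρ n) (ρ (n + 1)) := by
  obtain ⟨M, hM⟩ := exists_forall_ge_notMem (h.2.1 r hr (.refl hr) n)
  obtain ⟨M', hM'⟩ := exists_forall_ge_notMem (h.2.1 r' hr' (.of_adj hr hr' hadj) n)
  refine ⟨max M M', fun m hm => h.2.2 n _ ⟨M, fun k hk => ?_⟩⟩
  have hmM : M ≤ m := (le_max_left _ _).trans hm
  refine .trans ?_ (connAvoiding_ray hr hM hmM hk)
  rcases hadj m with h | h
  · rw [h]
    exact .refl (hM' m ((le_max_right _ _).trans hm))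
  · exact .of_adj h.symm (hM' m ((le_max_right _ _).trans hm)) (hM m hmM)

theorem IsRootedRay.notMem_above_of_ne {ρ ρ' : ℕ → N} (h : D.IsRootedRay ρ)
    (h' : D.IsRootedRay ρ') {n : ℕ} (hne : ρ (n + 1) ≠ ρ' (n + 1)) {p : V}
    (hp : p ∈ D.strictAbove (ρ n) (ρ (n + 1))) : p ∉ D.above (ρ' (n + 1)) := fun hp' => by
  obtain ⟨x, hx, hpx⟩ := mem_above.1 hp.1
  obtain ⟨y, hy, hpy⟩ := mem_above.1 hp'
  exact hp.2 ((h.isOrientedEdge n).mem_adh hx hpx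
    (fun hle => hne (h.eq_of_le h' hle hy)) hpy)

theorem exists_step {P : ℕ → Prop} {M : ℕ} (h0 : ¬ P 0) (hM : P M) :
    ∃ j, ¬ P j ∧ P (j + 1) := by
  by_contra! hcon
  have : ∀ j, ¬ P j := fun j => Nat.rec h0 (fun j ih => hcon j ih) j
  exact this M hM

/-- Each ray of a family converging to the end crosses all far out adhesion sets. -/
theorem GivesRise.eventually_meets {r r' : ℕ → V} {ρ : ℕ → N} (h : D.GivesRise r ρ)
    (hlim : D.bagLiminf ρ = ∅)
    (hr : IsRay G r) (hr' : IsRay G r') (hadj : ∀ j, r j = r' j ∨ G.Adj (r j) (r' j)) :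
    ∃ K, ∀ k ≥ K, ∃ j, r' j ∈ D.bag (ρ k) ∩ D.bag (ρ (k + 1)) := by
  obtain ⟨K, hK⟩ := h.1.exists_notMem_above hlim (r' 0)
  refine ⟨K, fun k hk => ?_⟩
  obtain ⟨M, hM⟩ := h.eventually_mem hr hr' hadj k
  obtain ⟨j, hj, hj'⟩ := exists_step (P := fun j => r' j ∈ D.above (ρ (k + 1)))
    (hK (k + 1) (by omega)) (hM M le_rfl).1
  exact ⟨j + 1, (h.1.isOrientedEdge k).mem_adh_of_adj (hr'.2 j).symm hj' hj⟩

/-- If the end of `r` has degree at most `d` and contains `d` disjoint rays `row i` close to `r`,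
then infinitely many adhesion sets along `ρ` consist of vertices on these rays. -/
theorem GivesRise.frequently_subset {d : ℕ} {r : ℕ → V} {ρ : ℕ → N} (h : D.GivesRise r ρ)
    (hlim : D.bagLiminf ρ = ∅) (hr : IsRay G r) {row : Fin d → ℕ → V}
    (hrow : ∀ i, IsRay G (row i)) (hadj : ∀ i j, r j = row i j ∨ G.Adj (r j) (row i j))
    (hdisj : ∀ i i' j j', row i j = row i' j' → i = i')
    (hdeg : D.adhLiminf ρ ≤ d) (K : ℕ) :
    ∃ k ≥ K, ∀ v ∈ D.bag (ρ k) ∩ D.bag (ρ (k + 1)), ∃ i j, v = row i j := by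
  choose L hL using fun i => h.eventually_meets hlim hr (hrow i) (hadj i)
  have hfreq : ∃ᶠ k in Filter.atTop,
      (D.bag (ρ k) ∩ D.bag (ρ (k + 1))).encard < (d : ℕ∞) + 1 := by
    refine Filter.frequently_lt_of_liminf_lt (by isBoundedDefault) ?_
    exact lt_of_le_of_lt hdeg (ENat.lt_add_one_iff (ENat.natCast_ne_top d) |>.2 le_rfl)
  obtain ⟨k, hk, hlt⟩ := Filter.frequently_atTop.1 hfreq (max K (Finset.univ.sup L))
  refine ⟨k, (le_max_left _ _).trans hk, ?_⟩
  have hkL : ∀ i, L i ≤ k := fun i =>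
    (Finset.le_sup (Finset.mem_univ i)).trans ((le_max_right _ _).trans hk)
  choose j hj using fun i => hL i k (hkL i)
  have hle : (D.bag (ρ k) ∩ D.bag (ρ (k + 1))).encard ≤ (d : ℕ∞) :=
    ENat.lt_add_one_iff (ENat.natCast_ne_top d) |>.1 hlt
  have hinj : Function.Injective fun i => row i (j i) := fun i i' hii => hdisj _ _ _ _ hii
  have hcard : (Set.range fun i => row i (j i)).encard = d := by
    rw [← Set.image_univ, hinj.encard_image, Set.encard_univ]
    simp
  have heq := Set.Finite.eq_of_subset_of_encard_le (Set.finite_range fun i => row i (j i))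
    (by rintro _ ⟨i, rfl⟩; exact hj i) (hcard ▸ hle)
  intro v hv
  rw [← heq] at hv
  obtain ⟨i, rfl⟩ := hv
  exact ⟨i, _, rfl⟩

end RootedTreeDecomp

/-- A sequence of ends, represented by the rays `axis n`, such that every small set separating
two consecutive ones contains the vertex `apex`, and which converges to the end of `limit`. -/
structure EndSequence {V : Type u} (G : SimpleGraph V) where
  apex : V
  deg : ℕ → ℕ
  row : (n : ℕ) → Fin (deg n) → ℕ → V
  axis : ℕ → ℕ → V
  sep : ℕ → Finset V
  limit : ℕ → V
  row_isRay : ∀ n i, IsRay G (row n i)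
  axis_isRay : ∀ n, IsRay G (axis n)
  axis_adj : ∀ n i j, axis n j = row n i j ∨ G.Adj (axis n j) (row n i j)
  axis_eq_row : ∀ n j, ∃ i, axis n j = row n i j
  row_inj : ∀ {n i j n' i' j'}, row n i j = row n' i' j' → n = n'
  row_disj : ∀ {n} (i i' j j'), row n i j = row n i' j' → i = i'
  le_deg : ∀ n m, HasDisjRays G (axis n) m → m ≤ deg n
  sep_spec : ∀ n i j i' j', ¬ ConnAvoiding G (sep n) (row n i j) (row (n + 1) i' j')
  conn : ∀ (n : ℕ) (Y : Set V), Y.encard ≤ (sep n).card → apex ∉ Y →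
    ∀ M, ∃ j ≥ M, ∃ j' ≥ M, ConnAvoiding G Y (axis n j) (axis (n + 1) j')
  limit_isRay : IsRay G limit
  detour : ∀ h : ℕ → ℕ, ∃ r, IsRay G r ∧ {k | r k ∈ Set.range limit}.Infinite ∧
    ∀ n, axis n (h n) ∈ Set.range r

namespace EndSequence

variable {V : Type u} {N : Type v} {G : SimpleGraph V} {T : SimpleGraph N}
  {D : RootedTreeDecomp G T}

theorem endDegree_le (S : EndSequence G) (n : ℕ) : EndDegree G (S.axis n) ≤ S.deg n :=
  iSup₂_le fun m hm => by exact_mod_cast S.le_deg n m hm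

theorem axis_inj (S : EndSequence G) {n j n' j' : ℕ} (h : S.axis n j = S.axis n' j') : n = n' := by
  obtain ⟨i, hi⟩ := S.axis_eq_row n j
  obtain ⟨i', hi'⟩ := S.axis_eq_row n' j'
  exact S.row_inj (hi.symm.trans (h.trans hi'))

theorem encard_le_of_disjointPathsFam (S : EndSequence G) {n : ℕ} {A B Y : Set V} {ι : Type u}
    (hY : Cardinal.mk Y = Cardinal.mk ι) (h : DisjointPathsFam G A B ι)
    (hX : ∀ a ∈ A, ∀ b ∈ B, ∀ p : G.Walk a b, ∃ x ∈ p.support, x ∈ S.sep n) :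
    Y.encard ≤ (S.sep n).card := by
  obtain ⟨a, b, p, -, ha, hb, hdisj⟩ := h
  choose x hx hxs using fun i => hX _ (ha i) _ (hb i) (p i)
  have hinj : Function.Injective fun i => (⟨x i, hxs i⟩ : {v // v ∈ S.sep n}) := by
    intro i i' hii
    by_contra hne
    have : x i = x i' := congrArg Subtype.val hii
    exact hdisj hne _ (hx i) (this ▸ hx i')
  have hle : Cardinal.mk Y ≤ ((S.sep n).card : Cardinal) := by
    rw [hY]
    exact (Cardinal.mk_le_of_injective hinj).trans (by simp)
  have := OrderHomClass.mono Cardinal.toENat hle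
  rwa [Cardinal.toENat_nat] at this

/-- In a strongly linked tree-decomposition, some adhesion set between two consecutive ends of the
sequence contains the apex. -/
theorem exists_apex_mem (S : EndSequence G) (hlink : D.toTreeDecomp.StronglyLinked)
    {n : ℕ} {ρ ρ' : ℕ → N}
    (h : D.GivesRise (S.axis n) ρ) (hlim : D.bagLiminf ρ = ∅) (hdeg : D.adhLiminf ρ ≤ S.deg n)
    (h' : D.GivesRise (S.axis (n + 1)) ρ') (hlim' : D.bagLiminf ρ' = ∅)
    (hdeg' : D.adhLiminf ρ' ≤ S.deg (n + 1)) :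
    ∃ j, ρ (j + 1) ≠ ρ' (j + 1) ∧ (S.apex ∈ D.bag (ρ j) ∩ D.bag (ρ (j + 1)) ∨
      S.apex ∈ D.bag (ρ' j) ∩ D.bag (ρ' (j + 1))) := by
  classical
  have hsub := h.frequently_subset hlim (S.axis_isRay n) (S.row_isRay n) (S.axis_adj n)
    S.row_disj hdeg
  have hsub' := h'.frequently_subset hlim' (S.axis_isRay _) (S.row_isRay _) (S.axis_adj _)
    S.row_disj hdeg'
  have hne : ∃ m, ρ m ≠ ρ' m := by
    by_contra! heq
    obtain rfl : ρ = ρ' := funext heq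
    obtain ⟨i, -⟩ := S.axis_eq_row (n + 1) 0
    obtain ⟨K, hK⟩ := h'.eventually_meets hlim' (S.axis_isRay _) (S.row_isRay _ i)
      (S.axis_adj _ i)
    obtain ⟨k, hk, hks⟩ := hsub K
    obtain ⟨j, hj⟩ := hK k hk
    obtain ⟨i', j', hij⟩ := hks _ hj
    have := S.row_inj hij
    omega
  obtain ⟨m, hm⟩ : ∃ m, Nat.find hne = m + 1 := by
    refine Nat.exists_eq_succ_of_ne_zero fun h0 => ?_
    have := Nat.find_spec hne
    rw [h0, h.1.2, h'.1.2] at this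
    exact this rfl
  have hdiv : ρ (m + 1) ≠ ρ' (m + 1) := hm ▸ Nat.find_spec hne
  have heq : ρ m = ρ' m := by
    by_contra hmne
    have := Nat.find_min' hne hmne
    omega
  have hdivs : ∀ j, m ≤ j → ρ (j + 1) ≠ ρ' (j + 1) := fun j hj =>
    h.1.ne_of_le h'.1 (by omega) hdiv
  obtain ⟨k, hk, hks⟩ := hsub m
  obtain ⟨k', hk', hks'⟩ := hsub' m
  have hst : ¬ D.le (ρ (k + 1)) (ρ' (k' + 1)) := fun hle =>
    hdiv (h.1.eq_of_le h'.1 ((h.1.le_of_le (by omega)).trans hle) (h'.1.le_of_le (by omega)))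
  have hts : ¬ D.le (ρ' (k' + 1)) (ρ (k + 1)) := fun hle =>
    hdiv (h.1.eq_of_le h'.1 (h.1.le_of_le (by omega)) ((h'.1.le_of_le (by omega)).trans hle))
  obtain ⟨c, -, ⟨a, b, ⟨hab, hmem⟩, hc⟩, ι, hι, hpaths⟩ :=
    hlink (ρ (k + 1)) (ρ' (k' + 1)) (fun he => hst (he ▸ RootedTreeDecomp.le.refl _))
  have hcard : (D.adh a b).encard ≤ (S.sep n).card := by
    refine S.encard_le_of_disjointPathsFam (hc.symm.trans hι.symm) hpaths fun x hx y hy p => ?_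
    by_contra! hav
    obtain ⟨v, hv, hve⟩ := (h.1.isOrientedEdge k).exists_mem_support p
      (RootedTreeDecomp.mem_above.2 ⟨_, RootedTreeDecomp.le.refl _, hx⟩) hy hst
    obtain ⟨w, hw, hwe⟩ := (h'.1.isOrientedEdge k').exists_mem_support p.reverse
      (RootedTreeDecomp.mem_above.2 ⟨_, RootedTreeDecomp.le.refl _, hy⟩) hx hts
    obtain ⟨i, j, rfl⟩ := hks v hve
    obtain ⟨i', j', rfl⟩ := hks' w hwe
    exact S.sep_spec n i j i' j' (.of_mem_support p hav hv (by simpa using hw))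
  obtain ⟨l, rfl⟩ := Nat.exists_eq_add_of_le hk
  obtain ⟨l', rfl⟩ := Nat.exists_eq_add_of_le hk'
  obtain ⟨p, -, -, -, hp⟩ := h.1.exists_isPath m (l + 1)
  obtain ⟨p', -, -, -, hp'⟩ := h'.1.exists_isPath m (l' + 1)
  have hedge := D.edges_path_subset (p.reverse.append (p'.copy heq.symm rfl)) hmem
  rw [SimpleGraph.Walk.edges_append, SimpleGraph.Walk.edges_copy,
    SimpleGraph.Walk.edges_reverse, List.mem_append, List.mem_reverse] at hedge
  have hadh : ∀ {s t : N}, s(a, b) = s(s, t) → D.adh a b = D.bag s ∩ D.bag t := by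
    intro s t hst
    rcases Sym2.eq_iff.1 hst with ⟨rfl, rfl⟩ | ⟨rfl, rfl⟩
    exacts [rfl, Set.inter_comm _ _]
  rcases hedge with hedge | hedge
  · obtain ⟨j, hj, hje⟩ := hp _ hedge
    rw [hadh hje] at hcard
    refine ⟨j, hdivs j hj, Or.inl ?_⟩
    by_contra hapex
    obtain ⟨M, hM⟩ := h.eventually_mem (S.axis_isRay _) (S.axis_isRay _) (fun _ => .inl rfl) j
    obtain ⟨M', hM'⟩ := h'.eventually_mem (S.axis_isRay _) (S.axis_isRay _) (fun _ => .inl rfl) j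
    obtain ⟨i, hi, i', hi', hcon⟩ := S.conn n _ hcard hapex (max M M')
    refine h'.1.notMem_above_of_ne h.1 (hdivs j hj).symm
      (hM' i' ((le_max_right _ _).trans hi'))
      (hcon.mem_of_closed (fun x hx y hxy _ hxn => ?_) (hM i ((le_max_left _ _).trans hi)).1)
    by_contra hy
    exact hxn ((h.1.isOrientedEdge j).mem_adh_of_adj hxy hx hy)
  · obtain ⟨j, hj, hje⟩ := hp' _ hedge
    rw [hadh hje] at hcard
    refine ⟨j, hdivs j hj, Or.inr ?_⟩
    by_contra hapex
    obtain ⟨M, hM⟩ := h.eventually_mem (S.axis_isRay _) (S.axis_isRay _) (fun _ => .inl rfl) j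
    obtain ⟨M', hM'⟩ := h'.eventually_mem (S.axis_isRay _) (S.axis_isRay _) (fun _ => .inl rfl) j
    obtain ⟨i, hi, i', hi', hcon⟩ := S.conn n _ hcard hapex (max M M')
    refine h.1.notMem_above_of_ne h'.1 (hdivs j hj) (hM i ((le_max_left _ _).trans hi))
      (hcon.symm.mem_of_closed (fun x hx y hxy _ hxn => ?_)
        (hM' i' ((le_max_right _ _).trans hi')).1)
    by_contra hy
    exact hxn ((h'.1.isOrientedEdge j).mem_adh_of_adj hxy hx hy)

theorem not_stronglyLinked (S : EndSequence G)
    (hD : ∀ r : ℕ → V, IsRay G r → ∃ ρ : ℕ → N, D.GivesRise r ρ ∧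
      D.bagLiminf ρ = ∅ ∧ D.adhLiminf ρ = EndDegree G r) :
    ¬ D.toTreeDecomp.StronglyLinked := by
  intro hlink
  choose σ hσ hσlim hσdeg using fun n => hD (S.axis n) (S.axis_isRay n)
  obtain ⟨ρ, hρ, hρlim, -⟩ := hD S.limit S.limit_isRay
  obtain ⟨J, hJ⟩ := hρ.1.exists_notMem_above hρlim S.apex
  have hpair : ∀ n, ∃ n' ≥ n, σ n' (J + 1) ≠ ρ (J + 1) := by
    intro n
    by_contra! hcon
    have h1 := hcon n le_rfl
    have h2 := hcon (n + 1) n.le_succ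
    obtain ⟨j, hne, hj⟩ := S.exists_apex_mem hlink (hσ n) (hσlim n)
      ((hσdeg n).le.trans (S.endDegree_le n)) (hσ (n + 1)) (hσlim (n + 1))
      ((hσdeg (n + 1)).le.trans (S.endDegree_le (n + 1)))
    have hJj : J ≤ j := by
      by_contra hlt
      exact (hσ n).1.ne_of_le (hσ (n + 1)).1 (n := J + 1) (by omega) hne (h1.trans h2.symm)
    refine hJ (J + 1) J.le_succ ?_
    rcases hj with hj | hj
    · rw [← h1]
      exact RootedTreeDecomp.mem_above.2 ⟨_, (hσ n).1.le_of_le (by omega), hj.2⟩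
    · rw [← h2]
      exact RootedTreeDecomp.mem_above.2 ⟨_, (hσ (n + 1)).1.le_of_le (by omega), hj.2⟩
  have hfar : ∀ n, ∃ m, σ n (J + 1) ≠ ρ (J + 1) → S.axis n m ∉ D.above (ρ (J + 1)) := by
    intro n
    obtain ⟨M, hM⟩ := (hσ n).eventually_mem (S.axis_isRay _) (S.axis_isRay _)
      (fun _ => .inl rfl) J
    exact ⟨M, fun hne => (hσ n).1.notMem_above_of_ne hρ.1 hne (hM M le_rfl)⟩
  choose h hh using hfar
  obtain ⟨r, hr, hinf, hmeet⟩ := S.detour h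
  obtain ⟨M, hM⟩ := exists_forall_ge_notMem
    (hρ.2.1 r hr (.of_infinite_inter S.limit_isRay hr hinf) J)
  obtain ⟨L, hL⟩ := hρ.eventually_mem S.limit_isRay S.limit_isRay (fun _ => .inl rfl) J
  have hfin : {k | r k ∈ S.limit '' Set.Iio L}.Finite :=
    ((Set.finite_Iio L).image S.limit).preimage hr.1.injOn
  obtain ⟨k, ⟨⟨l, hl⟩, hk⟩, hkM⟩ := (hinf.sdiff hfin).exists_gt M
  have hkin : r k ∈ D.above (ρ (J + 1)) := by
    rw [← hl]
    refine (hL l ?_).1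
    by_contra hlt
    exact hk ⟨l, not_le.1 hlt, hl⟩
  choose κ hκ using hmeet
  have hκinj : Function.Injective κ := fun n n' hnn =>
    S.axis_inj ((hκ n).symm.trans ((congrArg r hnn).trans (hκ n')))
  have hbad : {n | σ n (J + 1) ≠ ρ (J + 1)}.Infinite := by
    rw [Set.infinite_iff_exists_gt]
    intro n
    obtain ⟨n', hn', hne⟩ := hpair (n + 1)
    exact ⟨n', hne, by omega⟩
  obtain ⟨_, ⟨n, hn, rfl⟩, hkn⟩ := (hbad.image hκinj.injOn).exists_gt k
  have hout : r (κ n) ∉ D.above (ρ (J + 1)) := by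
    rw [hκ]
    exact hh n hn
  obtain ⟨d, hd⟩ := Nat.exists_eq_add_of_le hkn.le
  obtain ⟨j, hj, hj'⟩ := RootedTreeDecomp.exists_step
    (P := fun j => r (k + j) ∉ D.above (ρ (J + 1))) (M := d) (by simpa using hkin) (hd ▸ hout)
  exact hM (k + j) (by omega)
    ((hρ.1.isOrientedEdge J).mem_adh_of_adj (hr.2 (k + j)) (not_not.1 hj) hj').1

end EndSequence

/-- The graph on `V` obtained from `H` by blowing up each vertex `b` of `H` to a clique on the fibre
of `f` over `b`. -/
def SimpleGraph.blowUp {V : Type u} {B : Type v} (H : SimpleGraph B) (f : V → B) :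
    SimpleGraph V where
  Adj x y := x ≠ y ∧ (f x = f y ∨ H.Adj (f x) (f y))
  symm := ⟨fun _ _ h => ⟨h.1.symm, h.2.imp Eq.symm SimpleGraph.Adj.symm⟩⟩
  loopless := ⟨fun _ h => h.1 rfl⟩

section BlowUp

variable {V : Type u} {B : Type v} {H : SimpleGraph B} {f : V → B}

theorem ConnAvoiding.blowUp {Y : Set V} {x y : V}
    (h : ConnAvoiding H {b | f ⁻¹' {b} ⊆ Y} (f x) (f y)) (hx : x ∉ Y) (hy : y ∉ Y) :
    ConnAvoiding (H.blowUp f) Y x y := by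
  have same : ∀ {x y : V}, f x = f y → x ∉ Y → y ∉ Y → ConnAvoiding (H.blowUp f) Y x y := by
    intro x y hxy hx hy
    by_cases hne : x = y
    · exact hne ▸ .refl hx
    · exact .of_adj ⟨hne, .inl hxy⟩ hx hy
  obtain ⟨p, hp⟩ := h
  generalize hb : f x = b at p
  generalize hc : f y = c at p
  induction p generalizing x with
  | nil => exact same (hb.trans hc.symm) hx hy
  | @cons b d c hbd p ih =>
    obtain ⟨z, hzd, hzY⟩ : ∃ z, f z = d ∧ z ∉ Y := by
      simpa [Set.subset_def] using hp d (by simp)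
    refine .trans (.of_adj ⟨?_, .inr ?_⟩ hx hzY)
      (ih hzY hzd hc fun w hw => hp w (List.mem_cons_of_mem _ hw))
    · rintro rfl
      exact hbd.ne (hb.symm.trans hzd)
    · rwa [hb, hzd]

theorem ConnAvoiding.of_blowUp {X : Set B} {Y : Set V} {x y : V}
    (h : ConnAvoiding (H.blowUp f) Y x y) (hXY : f ⁻¹' X ⊆ Y) : ConnAvoiding H X (f x) (f y) := by
  refine h.mem_of_closed (C := {y | ConnAvoiding H X (f x) (f y)}) ?_
    (.refl fun hx => h.symm.right_notMem (hXY hx))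
  rintro a ha b ⟨-, hab | hab⟩ hb ha'
  · exact Set.mem_ofPred.2 (hab ▸ Set.mem_ofPred.1 ha)
  · exact ha.trans (.of_adj hab (fun h => ha' (hXY h)) fun h => hb (hXY h))

theorem LocFin.blowUp (hH : LocFin H) (hf : ∀ b, (f ⁻¹' {b}).Finite) : LocFin (H.blowUp f) := by
  intro x
  refine (((hH (f x)).insert (f x)).biUnion fun b _ => hf b).subset ?_
  rintro y ⟨-, h | h⟩
  · exact Set.mem_biUnion (Set.mem_insert _ _) h.symm
  · exact Set.mem_biUnion (Set.mem_insert_of_mem _ h) rfl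

end BlowUp

/-- The vertices of a graph which is blown up to obtain the counterexample. -/
inductive Blob
  | bridge (n : ℕ)
  | gate (n : ℕ)
  | bypass (n : ℕ)
  | column (n j : ℕ)

namespace Blob

/-- The number of vertices to which a vertex is blown up. -/
def size : Blob → ℕ
  | bridge n => n + 1
  | gate _ => 1
  | bypass n => n + 2
  | column n _ => 2 * n + 4

@[simp] theorem size_bridge (n : ℕ) : (bridge n).size = n + 1 := rfl
@[simp] theorem size_gate (n : ℕ) : (gate n).size = 1 := rfl
@[simp] theorem size_bypass (n : ℕ) : (bypass n).size = n + 2 := rfl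
@[simp] theorem size_column (n j : ℕ) : (column n j).size = 2 * n + 4 := rfl

/-- The edges of the graph on `Blob`, with an orientation. -/
inductive Arrow : Blob → Blob → Prop
  | enter (n) : Arrow (bridge n) (column n 0)
  | leave (n) : Arrow (column n 0) (bridge (n + 1))
  | climb (n j) : Arrow (column n j) (column n (j + 1))
  | toGate (n) : Arrow (column n 0) (gate n)
  | toBypass (n) : Arrow (gate n) (bypass n)
  | along (n) : Arrow (bypass n) (bypass (n + 1))

theorem Arrow.ne {a b : Blob} (h : Arrow a b) : a ≠ b := by
  cases h <;> simp

/-- Infinitely many rays `column n`, consecutive ones being joined by a bridge, and all of them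
being joined to the ray `bypass` by gates. -/
def graph : SimpleGraph Blob where
  Adj a b := Arrow a b ∨ Arrow b a
  symm := ⟨fun _ _ h => h.symm⟩
  loopless := ⟨fun _ h => h.elim (fun h => h.ne rfl) (fun h => h.ne rfl)⟩

theorem locFin_graph : LocFin graph := by
  intro b
  cases b with
  | bridge n =>
    refine Set.Finite.subset (s := {column n 0, column (n - 1) 0}) (by simp) ?_
    rintro _ (h | h) <;> cases h <;> simp
  | gate n =>
    refine Set.Finite.subset (s := {column n 0, bypass n}) (by simp) ?_
    rintro _ (h | h) <;> cases h <;> simp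
  | bypass n =>
    refine Set.Finite.subset (s := {gate n, bypass (n + 1), bypass (n - 1)}) (by simp) ?_
    rintro _ (h | h) <;> cases h <;> simp
  | column n j =>
    refine Set.Finite.subset (s := {bridge n, bridge (n + 1), gate n, column n (j + 1),
      column n (j - 1)}) (by simp) ?_
    rintro _ (h | h) <;> cases h <;> simp

section Paths

variable {X : Set Blob}

theorem Arrow.connAvoiding {a b : Blob} (h : Arrow a b) (ha : a ∉ X) (hb : b ∉ X) :
    ConnAvoiding graph X a b :=
  .of_adj (.inl h) ha hb

theorem connAvoiding_column {n : ℕ} (h : ∀ j, column n j ∉ X) (j j' : ℕ) :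
    ConnAvoiding graph X (column n j) (column n j') := by
  have key : ∀ j, ConnAvoiding graph X (column n 0) (column n j) := by
    intro j
    induction j with
    | zero => exact .refl (h 0)
    | succ j ih => exact ih.trans ((Arrow.climb n j).connAvoiding (h _) (h _))
  exact (key j).symm.trans (key j')

theorem connAvoiding_columns {n m : ℕ} (hnm : n ≤ m) (hc : ∀ k, n ≤ k → column k 0 ∉ X)
    (hb : ∀ k, n < k → k ≤ m → bridge k ∉ X) :
    ConnAvoiding graph X (column n 0) (column m 0) := by
  induction m, hnm using Nat.le_induction with
  | base => exact .refl (hc n le_rfl)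
  | succ m hm ih =>
    have hbm := hb (m + 1) (by omega) le_rfl
    exact ((ih fun k h h' => hb k h (by omega)).trans
      ((Arrow.leave m).connAvoiding (hc m hm) hbm)).trans
      ((Arrow.enter (m + 1)).connAvoiding hbm (hc _ (by omega)))

theorem connAvoiding_bypass {n m : ℕ} (hnm : n ≤ m) (h : ∀ k, n ≤ k → bypass k ∉ X) :
    ConnAvoiding graph X (bypass n) (bypass m) := by
  induction m, hnm using Nat.le_induction with
  | base => exact .refl (h n le_rfl)
  | succ m hm ih => exact ih.trans ((Arrow.along m).connAvoiding (h m hm) (h _ (by omega)))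

theorem connAvoiding_bypass_column {n : ℕ} (hw : bypass n ∉ X) (hg : gate n ∉ X)
    (hc : column n 0 ∉ X) : ConnAvoiding graph X (bypass n) (column n 0) :=
  ((Arrow.toGate n).connAvoiding hc hg |>.trans ((Arrow.toBypass n).connAvoiding hg hw)).symm

end Paths

theorem connAvoiding_empty (a b : Blob) : ConnAvoiding graph ∅ a b := by
  have hcol : ∀ n, ConnAvoiding graph ∅ (column 0 0) (column n 0) := fun n =>
    connAvoiding_columns n.zero_le (by simp) (by simp)
  have key : ∀ b, ConnAvoiding graph ∅ (column 0 0) b := by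
    rintro (n | n | n | ⟨n, j⟩)
    · exact (hcol n).trans ((Arrow.enter n).connAvoiding (by simp) (by simp)).symm
    · exact (hcol n).trans ((Arrow.toGate n).connAvoiding (by simp) (by simp))
    · exact (hcol n).trans (connAvoiding_bypass_column (by simp) (by simp) (by simp)).symm
    · exact (hcol n).trans (connAvoiding_column (by simp) _ _)
  exact (key a).symm.trans (key b)

theorem size_pos : ∀ b : Blob, 0 < b.size
  | bridge _ | gate _ | bypass _ | column _ _ => by simp [size]

instance : Countable Blob :=
  Function.Injective.countable (β := ℕ × ℕ × ℕ) (f := fun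
    | bridge n => (0, n, 0)
    | gate n => (1, n, 0)
    | bypass n => (2, n, 0)
    | column n j => (3, n, j)) <| by
    rintro (_ | _ | _ | _) (_ | _ | _ | _) <;> simp

theorem nonempty_equiv : Nonempty (ℕ ≃ Σ b : Blob, Fin b.size) := by
  have : Infinite (Σ b : Blob, Fin b.size) :=
    .of_injective (fun n => ⟨bridge n, 0, size_pos _⟩) fun n m h => by
      simpa using congrArg Sigma.fst h
  obtain ⟨_⟩ := nonempty_denumerable (Σ b : Blob, Fin b.size)
  exact ⟨(Denumerable.eqv _).symm⟩

/-- The gates, as an embedding. -/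
def gateEmbedding : ℕ ↪ Blob := ⟨gate, fun _ _ => by simp⟩

@[simp] theorem gateEmbedding_apply (n : ℕ) : gateEmbedding n = gate n := rfl

/-- The blobs whose vertices separate the columns up to `n` from the following ones. -/
def cut (n : ℕ) : Finset Blob :=
  .cons (bridge (n + 1)) ((Finset.range (n + 1)).map gateEmbedding) (by simp)

theorem not_connAvoiding_cut {n j j' : ℕ} :
    ¬ ConnAvoiding graph (cut n) (column n j) (column (n + 1) j') := by
  intro h
  have := h.mem_of_closed
    (C := {b | ∃ m ≤ n, b = bridge m ∨ ∃ j, b = column m j}) ?_ ⟨n, le_rfl, .inr ⟨j, rfl⟩⟩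
  · obtain ⟨m, hm, h | ⟨j, h⟩⟩ := this
    · simp at h
    · simp only [column.injEq] at h
      omega
  · rintro _ ⟨m, hm, rfl | ⟨j, rfl⟩⟩ b hb hbX -
    · rcases hb with hb | hb <;> cases hb
      · exact ⟨m, hm, .inr ⟨0, rfl⟩⟩
      · exact ⟨_, (Nat.le_succ _).trans hm, .inr ⟨0, rfl⟩⟩
    · rcases hb with hb | hb <;> cases hb
      · refine ⟨_, Nat.succ_le_of_lt (lt_of_le_of_ne hm ?_), .inl rfl⟩
        rintro rfl
        simp [cut] at hbX
      · exact ⟨m, hm, .inr ⟨_, rfl⟩⟩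
      · simp [cut] at hbX
        omega
      · exact ⟨m, hm, .inl rfl⟩
      · exact ⟨m, hm, .inr ⟨_, rfl⟩⟩

end Blob

section Counterexample

open Blob

variable {V : Type u} (e : V ≃ Σ b : Blob, Fin b.size)

/-- The blob of a vertex. -/
def blobOf (x : V) : Blob := (e x).1

/-- The graph obtained from `Blob.graph` by blowing up each `b` to `b.size` vertices. -/
abbrev blobGraph : SimpleGraph V := Blob.graph.blowUp (blobOf e)

/-- The vertex with number `i` in the blob `b`. -/
def vertexOf (b : Blob) (i : Fin b.size) : V := e.symm ⟨b, i⟩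

@[simp] theorem blobOf_vertexOf (b : Blob) (i : Fin b.size) : blobOf e (vertexOf e b i) = b := by
  simp [blobOf, vertexOf]

theorem vertexOf_injective (b : Blob) : Function.Injective (vertexOf e b) := fun i j h => by
  simpa using e.symm.injective h

/-- The set of all vertices in the blobs of `K`. -/
def verticesOver (K : Finset Blob) : Finset V :=
  (K.sigma fun _ => Finset.univ).map e.symm.toEmbedding

@[simp] theorem mem_verticesOver {K : Finset Blob} {x : V} :
    x ∈ verticesOver e K ↔ blobOf e x ∈ K := by
  simp only [verticesOver, Finset.mem_map_equiv, Finset.mem_sigma, Finset.mem_univ, and_true,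
    Equiv.symm_symm, blobOf]

theorem card_verticesOver (K : Finset Blob) : (verticesOver e K).card = ∑ b ∈ K, b.size := by
  simp [verticesOver]

theorem locFin_blobGraph : LocFin (blobGraph e) :=
  Blob.locFin_graph.blowUp fun b => (verticesOver e {b}).finite_toSet.subset fun x hx => by
    simpa using hx

/-- The blobs all of whose vertices lie in `Y`. -/
abbrev deadBlobs (Y : Set V) : Set Blob := {b | blobOf e ⁻¹' {b} ⊆ Y}

theorem sum_size_le {Y : Set V} {K : Finset Blob} (h : ∀ b ∈ K, b ∈ deadBlobs e Y) :
    ((∑ b ∈ K, b.size : ℕ) : ℕ∞) ≤ Y.encard := by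
  rw [← card_verticesOver e, ← Set.encard_coe_eq_coe_finsetCard]
  refine Set.encard_le_encard fun x hx => h (blobOf e x) ?_ rfl
  simpa using hx

theorem size_le {Y : Set V} {b : Blob} (h : b ∈ deadBlobs e Y) : (b.size : ℕ∞) ≤ Y.encard := by
  simpa using sum_size_le e (K := {b}) (by simpa using h)

theorem connected_blobGraph : (blobGraph e).Connected := by
  have : Nonempty V := ⟨vertexOf e (bridge 0) ⟨0, size_pos _⟩⟩
  refine ⟨fun x y => ?_⟩
  have hdead : deadBlobs e ∅ = ∅ := Set.eq_empty_of_forall_notMem fun b hb =>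
    hb (blobOf_vertexOf e b ⟨0, size_pos b⟩)
  have h : ConnAvoiding (blobGraph e) ∅ x y :=
    ConnAvoiding.blowUp (hdead.symm ▸ connAvoiding_empty _ _ :
      ConnAvoiding Blob.graph (deadBlobs e ∅) _ _) (Set.notMem_empty _) (Set.notMem_empty _)
  exact h.choose.reachable

/-- A set of vertices which contains the bridge to column `n + 1`, but not all gates up to `n`, and
is at most as large as the `n`-th cut cannot contain sufficiently many blobs to separate the columns
`n` and `n + 1`. -/
theorem connAvoiding_columns_of_bridge_mem {n : ℕ} {Y : Set V}
    (hY : Y.encard ≤ (2 * n + 3 : ℕ)) (h0 : gate 0 ∉ deadBlobs e Y)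
    (hbridge : bridge (n + 1) ∈ deadBlobs e Y) :
    ConnAvoiding Blob.graph (deadBlobs e Y) (column n 0) (column (n + 1) 0) := by
  classical
  set i := Nat.findGreatest (fun i => gate i ∉ deadBlobs e Y) n
  have hi : gate i ∉ deadBlobs e Y :=
    Nat.findGreatest_spec (P := fun i => gate i ∉ deadBlobs e Y) n.zero_le h0
  have hin : i ≤ n := Nat.findGreatest_le n
  have hgates : ∀ k, i < k → k ≤ n → gate k ∈ deadBlobs e Y := fun k hk hkn =>
    not_not.1 (Nat.findGreatest_is_greatest hk hkn)
  have hlarge : ∀ b : Blob, b ≠ bridge (n + 1) → (∀ k, b ≠ gate k) → i + 2 ≤ b.size →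
      b ∉ deadBlobs e Y := by
    intro b hb hbg hsize hdead
    have hsum := (sum_size_le e (Y := Y) (K := .cons b (.cons (bridge (n + 1))
      ((Finset.Ioc i n).map gateEmbedding) (by simp)) (by
        simpa [hb] using fun k _ _ => (hbg k).symm)) (by
        simp only [Finset.mem_cons, Finset.mem_map, Finset.mem_Ioc, gateEmbedding_apply]
        rintro _ (rfl | rfl | ⟨k, ⟨hk, hkn⟩, rfl⟩)
        exacts [hdead, hbridge, hgates k hk hkn])).trans hY
    simp only [Finset.sum_cons, Finset.sum_map, gateEmbedding_apply, size_bridge, size_gate,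
      Finset.sum_const, Nat.card_Ioc, Nat.cast_le, smul_eq_mul, mul_one] at hsum
    omega
  have hcol : ∀ k, i ≤ k → column k 0 ∉ deadBlobs e Y := fun k hk =>
    hlarge _ (by simp) (by simp) (by simp; omega)
  have hbyp : ∀ k, i ≤ k → bypass k ∉ deadBlobs e Y := fun k hk =>
    hlarge _ (by simp) (by simp) (by simp; omega)
  have hbri : ∀ k, i < k → k ≠ n + 1 → bridge k ∉ deadBlobs e Y := fun k hk hkn =>
    hlarge _ (by simpa using hkn) (by simp) (by simp; omega)
  obtain ⟨m, hm, hmn⟩ : ∃ m, gate m ∉ deadBlobs e Y ∧ n + 1 ≤ m := by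
    by_contra! hcon
    have hfin := sum_size_le e (Y := Y)
      (K := (Finset.Icc (n + 1) (3 * n + 4)).map gateEmbedding) (by
        simp only [Finset.mem_map, Finset.mem_Icc, gateEmbedding_apply]
        rintro _ ⟨k, ⟨hk, -⟩, rfl⟩
        by_contra hkd
        have := hcon k hkd
        omega) |>.trans hY
    simp only [Finset.sum_map, gateEmbedding_apply, size_gate,
      Finset.sum_const, Nat.card_Icc, Nat.cast_le, smul_eq_mul, mul_one] at hfin
    omega
  refine (connAvoiding_columns hin (fun k hk => hcol k hk)
    fun k hk hkn => hbri k hk (by omega)).symm.trans ?_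
  refine (connAvoiding_bypass_column (hbyp i le_rfl) hi (hcol i le_rfl)).symm.trans ?_
  refine (connAvoiding_bypass (hin.trans ((Nat.le_succ n).trans hmn)) hbyp).trans ?_
  refine (connAvoiding_bypass_column (hbyp m (by omega)) hm (hcol m (by omega))).trans ?_
  exact (connAvoiding_columns hmn (fun k hk => hcol k (hin.trans ((Nat.le_succ n).trans hk)))
    fun k hk _ => hbri k ((Nat.lt_succ_of_le hin).trans hk) hk.ne').symm

theorem connAvoiding_column_succ {n : ℕ} {Y : Set V} (hY : Y.encard ≤ (2 * n + 3 : ℕ))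
    (h0 : gate 0 ∉ deadBlobs e Y) (j j' : ℕ) :
    ConnAvoiding Blob.graph (deadBlobs e Y) (column n j) (column (n + 1) j') := by
  have hcol : ∀ k j, n ≤ k → column k j ∉ deadBlobs e Y := by
    intro k j hk hdead
    have : 2 * k + 4 ≤ 2 * n + 3 := by exact_mod_cast (size_le e hdead).trans hY
    omega
  refine (connAvoiding_column (fun j => hcol n j le_rfl) j 0).trans ?_
  refine .trans ?_ (connAvoiding_column (fun j => hcol (n + 1) j n.le_succ) 0 j')
  by_cases hbridge : bridge (n + 1) ∈ deadBlobs e Y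
  · exact connAvoiding_columns_of_bridge_mem e hY h0 hbridge
  · exact ((Arrow.leave n).connAvoiding (hcol _ _ le_rfl) hbridge).trans
      ((Arrow.enter (n + 1)).connAvoiding hbridge (hcol _ _ n.le_succ))

/-- The `i`-th of the disjoint rays in the blobs of column `n`. -/
def columnRay (n : ℕ) (i : Fin (2 * n + 4)) (j : ℕ) : V := vertexOf e (column n j) i

@[simp] theorem blobOf_columnRay (n : ℕ) (i : Fin (2 * n + 4)) (j : ℕ) :
    blobOf e (columnRay e n i j) = column n j :=
  blobOf_vertexOf e _ _

theorem columnRay_inj {n : ℕ} {i i' : Fin (2 * n + 4)} {j j' : ℕ}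
    (h : columnRay e n i j = columnRay e n i' j') : i = i' ∧ j = j' := by
  obtain rfl : j = j' := by simpa using congrArg (blobOf e) h
  exact ⟨vertexOf_injective e _ h, rfl⟩

theorem blobGraph_adj_of_arrow {x y : V} (h : Arrow (blobOf e x) (blobOf e y)) :
    (blobGraph e).Adj x y :=
  ⟨fun hxy => h.ne (congrArg _ hxy), .inr (.inl h)⟩

theorem isRay_columnRay (n : ℕ) (i : Fin (2 * n + 4)) :
    IsRay (blobGraph e) (columnRay e n i) := by
  refine ⟨fun j j' h => ?_, fun j => blobGraph_adj_of_arrow e (by simpa using .climb n j)⟩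
  simpa using congrArg (blobOf e) h

theorem le_of_hasDisjRays_columnRay {n m : ℕ} {i : Fin (2 * n + 4)}
    (h : HasDisjRays (blobGraph e) (columnRay e n i) m) : m ≤ 2 * n + 4 := by
  obtain ⟨f, hf, hequiv, hdisj⟩ := h
  obtain ⟨J, hJ⟩ : ∃ J, ∀ k j, J < j → blobOf e (f k 0) ≠ column n j := by
    have : ∀ k, ∃ J, ∀ j, J < j → blobOf e (f k 0) ≠ column n j := by
      intro k
      by_cases hk : ∃ j, blobOf e (f k 0) = column n j
      · obtain ⟨j, hj⟩ := hk
        exact ⟨j, fun j' hj' => by simp [hj, hj'.ne]⟩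
      · push Not at hk
        exact ⟨0, fun j _ => hk j⟩
    choose J hJ using this
    exact ⟨Finset.univ.sup J, fun k j hj =>
      hJ k j ((Finset.le_sup (Finset.mem_univ k)).trans_lt hj)⟩
  have hmeet : ∀ k, ∃ l, blobOf e (f k l) = column n J := by
    intro k
    by_contra! hmiss
    obtain ⟨M, hM⟩ := hequiv k _ (verticesOver e {column n J}).finite_toSet
    have hcon := (hM (max M (J + 1)) (le_max_left _ _) M le_rfl).trans
      (connAvoiding_ray (hf k) (M := 0) (fun l _ => by simpa using hmiss l) (Nat.zero_le M) le_rfl)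
    obtain ⟨j, hj, hkj⟩ := hcon.mem_of_closed (C := {x | ∃ j, J < j ∧ blobOf e x = column n j}) (by
      rintro x ⟨j, hj, hx⟩ y ⟨-, hxy⟩ hy -
      rw [hx] at hxy
      rw [Finset.mem_coe, mem_verticesOver, Finset.mem_singleton] at hy
      change blobOf e y ∈ {b | ∃ j, J < j ∧ b = column n j}
      generalize blobOf e y = b at hxy hy
      rcases hxy with rfl | hxy | hxy
      · exact ⟨j, hj, rfl⟩
      · cases hxy
        · omega
        · exact ⟨_, hj.trans (Nat.lt_succ_self _), rfl⟩
        · omega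
      · cases hxy
        · omega
        · refine ⟨_, lt_of_le_of_ne (Nat.le_of_lt_succ hj) ?_, rfl⟩
          rintro rfl
          exact hy rfl)
      ⟨max M (J + 1), by omega, by simp⟩
    exact hJ k j hj hkj
  choose l hl using hmeet
  have hinj : Function.Injective fun k => f k (l k) := by
    intro k k' hkk
    by_contra hne
    exact hdisj hne _ _ hkk
  have := Finset.card_le_card_of_injOn (s := Finset.univ) (t := verticesOver e {column n J})
    (fun k => f k (l k)) (by simp [Set.MapsTo, hl]) hinj.injOn
  simpa [card_verticesOver] using this

/-- The vertex in which the detours pass the bridge to column `n`. -/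
def bridgeVertex (n : ℕ) : V := vertexOf e (bridge n) ⟨0, size_pos _⟩

@[simp] theorem blobOf_bridgeVertex (n : ℕ) : blobOf e (bridgeVertex e n) = bridge n :=
  blobOf_vertexOf e _ _

/-- The vertex at position `p.2` of the `p.1`-th section of a walk which passes the bridges one
after another and meanwhile climbs each column `n` up to height `h n`. -/
def detourVertex (h : ℕ → ℕ) (p : ℕ × ℕ) : V :=
  if p.2 = 0 then bridgeVertex e p.1
  else if p.2 ≤ h p.1 + 1 then columnRay e p.1 0 (p.2 - 1)
  else columnRay e p.1 1 (2 * h p.1 + 2 - p.2)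

/-- The successor of a position in the walk described by `detourVertex`. -/
def detourStep (h : ℕ → ℕ) (p : ℕ × ℕ) : ℕ × ℕ :=
  if p.2 < 2 * h p.1 + 2 then (p.1, p.2 + 1) else (p.1 + 1, 0)

/-- The walk described by `detourVertex`. -/
def detourRay (h : ℕ → ℕ) (k : ℕ) : V := detourVertex e h ((detourStep h)^[k] (0, 0))

theorem adj_detourStep (h : ℕ → ℕ) {p : ℕ × ℕ} (hp : p.2 ≤ 2 * h p.1 + 2) :
    (blobGraph e).Adj (detourVertex e h p) (detourVertex e h (detourStep h p)) := by
  obtain ⟨n, k⟩ := p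
  simp only at hp
  by_cases hlast : k = 2 * h n + 2
  · refine (blobGraph_adj_of_arrow e ?_)
    simpa [detourVertex, detourStep, hlast, show ¬ 2 * h n + 2 ≤ h n + 1 by omega] using .leave n
  have hstep : detourStep h (n, k) = (n, k + 1) := if_pos (by simp only; omega)
  rw [hstep]
  rcases Nat.eq_zero_or_pos k with rfl | hk
  · refine (blobGraph_adj_of_arrow e ?_)
    simpa [detourVertex] using .enter n
  obtain ⟨k, rfl⟩ := Nat.exists_eq_succ_of_ne_zero hk.ne'
  rcases lt_trichotomy k (h n) with hkn | rfl | hkn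
  · refine (blobGraph_adj_of_arrow e ?_)
    simpa [detourVertex, hkn.le, Nat.succ_le_of_lt hkn] using .climb n k
  · have h1 : ¬ h n + 1 + 1 ≤ h n + 1 := by omega
    have h2 : 2 * h n + 2 - (h n + 1 + 1) = h n := by omega
    simp only [detourVertex, Nat.succ_ne_zero, if_false, le_refl, if_true, h1, h2,
      Nat.succ_eq_add_one, Nat.add_sub_cancel]
    refine ⟨fun heq => ?_, .inl (by simp)⟩
    simpa [Fin.ext_iff] using (columnRay_inj e heq).1
  · refine (blobGraph_adj_of_arrow e ?_).symm
    obtain ⟨d, hd⟩ := Nat.exists_eq_add_of_le (show k + 2 ≤ 2 * h n + 2 by omega)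
    have h1 : 2 * h n + 2 - (k + 1) = d + 1 := by omega
    have h2 : 2 * h n + 2 - (k + 1 + 1) = d := by omega
    simpa [detourVertex, hkn.not_ge, (Nat.lt_succ_of_lt hkn).not_ge, h1, h2] using .climb n d

theorem detourVertex_injOn (h : ℕ → ℕ) :
    Set.InjOn (detourVertex e h) {p | p.2 ≤ 2 * h p.1 + 2} := by
  rintro ⟨n, k⟩ hk ⟨n', k'⟩ hk' heq
  rw [Set.mem_ofPred] at hk hk'
  have hblob := congrArg (blobOf e) heq
  have hn : n = n' := by
    simp only [detourVertex, apply_ite (blobOf e), blobOf_columnRay, blobOf_bridgeVertex] at hblob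
    split_ifs at hblob <;> simp_all
  subst hn
  simp only at hk hk'
  have h01 : (0 : Fin (2 * n + 4)) ≠ 1 := by simp
  suffices k = k' by rw [this]
  simp only [detourVertex] at heq hblob
  split_ifs at heq hblob with h1 h2 h3 h4 h5 h6 h7
  · omega
  · simp at hblob
  · simp at hblob
  · simp at hblob
  · have := (columnRay_inj e heq).2
    omega
  · exact absurd (columnRay_inj e heq).1 h01
  · simp at hblob
  · exact absurd (columnRay_inj e heq).1.symm h01
  · have := (columnRay_inj e heq).2
    omega

theorem detourStep_iterate_le (h : ℕ → ℕ) (k : ℕ) :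
    ((detourStep h)^[k] (0, 0)).2 ≤ 2 * h ((detourStep h)^[k] (0, 0)).1 + 2 := by
  cases k with
  | zero => simp
  | succ k =>
    rw [Function.iterate_succ_apply']
    unfold detourStep
    split_ifs with hlt
    · exact hlt
    · exact Nat.zero_le _

theorem detourStep_iterate_injective (h : ℕ → ℕ) :
    Function.Injective fun k => (detourStep h)^[k] (0, 0) := by
  have : StrictMono fun k => toLex ((detourStep h)^[k] (0, 0)) := by
    refine strictMono_nat_of_lt_succ fun k => ?_
    rw [Function.iterate_succ_apply', Prod.Lex.toLex_lt_toLex]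
    generalize (detourStep h)^[k] (0, 0) = p
    unfold detourStep
    split_ifs <;> simp
  exact fun k l hkl => this.injective (congrArg toLex hkl)

theorem exists_detourStep_iterate (h : ℕ → ℕ) {p : ℕ × ℕ} (hp : p.2 ≤ 2 * h p.1 + 2) :
    ∃ k, (detourStep h)^[k] (0, 0) = p := by
  obtain ⟨n, q⟩ := p
  have climb : ∀ n, (∃ k, (detourStep h)^[k] (0, 0) = (n, 0)) → ∀ q ≤ 2 * h n + 2,
      ∃ k, (detourStep h)^[k] (0, 0) = (n, q) := by
    intro n hn q
    induction q with
    | zero => exact fun _ => hn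
    | succ q ih =>
      intro hq
      obtain ⟨k, hk⟩ := ih (by omega)
      refine ⟨k + 1, ?_⟩
      rw [Function.iterate_succ_apply', hk]
      exact if_pos hq
  refine climb n ?_ q hp
  induction n generalizing q with
  | zero => exact ⟨0, rfl⟩
  | succ n ih =>
    obtain ⟨k, hk⟩ := climb n (ih 0 (Nat.zero_le _)) _ le_rfl
    refine ⟨k + 1, ?_⟩
    rw [Function.iterate_succ_apply', hk]
    exact if_neg (lt_irrefl _)

theorem isRay_detourRay (h : ℕ → ℕ) : IsRay (blobGraph e) (detourRay e h) := by
  refine ⟨fun k l hkl => ?_, fun k => ?_⟩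
  · exact detourStep_iterate_injective h (detourVertex_injOn e h (detourStep_iterate_le h k)
      (detourStep_iterate_le h l) hkl)
  · unfold detourRay
    rw [Function.iterate_succ_apply']
    exact adj_detourStep e h (detourStep_iterate_le h k)

theorem detourVertex_mem_range (h : ℕ → ℕ) {p : ℕ × ℕ} (hp : p.2 ≤ 2 * h p.1 + 2) :
    detourVertex e h p ∈ Set.range (detourRay e h) := by
  obtain ⟨k, hk⟩ := exists_detourStep_iterate h hp
  exact ⟨k, congrArg _ hk⟩

theorem bridgeVertex_mem_range (h : ℕ → ℕ) (n : ℕ) :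
    bridgeVertex e n ∈ Set.range (detourRay e h) := by
  simpa [detourVertex] using detourVertex_mem_range e h (p := (n, 0)) (Nat.zero_le _)

theorem columnRay_mem_range (h : ℕ → ℕ) (n : ℕ) :
    columnRay e n 0 (h n) ∈ Set.range (detourRay e h) := by
  simpa [detourVertex] using detourVertex_mem_range e h (p := (n, h n + 1)) (by simp; omega)

/-- The ends of the columns of `blobGraph`. -/
def columnEnds : EndSequence (blobGraph e) where
  apex := vertexOf e (gate 0) ⟨0, size_pos _⟩
  deg n := 2 * n + 4
  row := columnRay e
  axis n := columnRay e n 0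
  sep n := verticesOver e (cut n)
  limit := detourRay e 0
  row_isRay := isRay_columnRay e
  axis_isRay n := isRay_columnRay e n 0
  axis_adj n i j := by
    by_cases hi : columnRay e n 0 j = columnRay e n i j
    · exact .inl hi
    · exact .inr ⟨hi, .inl (by simp)⟩
  axis_eq_row n j := ⟨0, rfl⟩
  row_inj {n i j n' i' j'} h := by
    have := congrArg (blobOf e) h
    simp only [blobOf_columnRay, column.injEq] at this
    exact this.1
  row_disj {n} i i' j j' h := (columnRay_inj e h).1
  le_deg n m h := le_of_hasDisjRays_columnRay e h
  sep_spec n i j i' j' h := by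
    have := h.of_blowUp (X := cut n) fun x hx => by simpa using hx
    simp only [blobOf_columnRay] at this
    exact not_connAvoiding_cut this
  conn n Y hY hapex M := by
    rw [card_verticesOver] at hY
    have hcut : ∑ b ∈ cut n, b.size = 2 * n + 3 := by
      simp only [cut, Finset.sum_cons, Finset.sum_map, gateEmbedding_apply, size_bridge, size_gate,
        Finset.sum_const, Finset.card_range, smul_eq_mul, mul_one]
      omega
    rw [hcut] at hY
    have hfin : Y.Finite := Set.finite_of_encard_le_coe hY
    obtain ⟨j, hj⟩ := (isRay_columnRay e n 0).exists_forall_ge_notMem hfin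
    obtain ⟨j', hj'⟩ := (isRay_columnRay e (n + 1) 0).exists_forall_ge_notMem hfin
    refine ⟨max M j, le_max_left _ _, max M j', le_max_left _ _, ConnAvoiding.blowUp ?_
      (hj _ (le_max_right _ _)) (hj' _ (le_max_right _ _))⟩
    rw [blobOf_columnRay, blobOf_columnRay]
    exact connAvoiding_column_succ e hY
      (fun h => hapex (h (blobOf_vertexOf e (gate 0) ⟨0, size_pos _⟩))) _ _
  limit_isRay := isRay_detourRay e 0
  detour h := by
    refine ⟨detourRay e h, isRay_detourRay e h, ?_, columnRay_mem_range e h⟩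
    choose k hk using bridgeVertex_mem_range e h
    refine (Set.infinite_range_of_injective (f := k) fun n m hnm => ?_).mono ?_
    · simpa using congrArg (blobOf e) ((hk n).symm.trans ((congrArg _ hnm).trans (hk m)))
    · rintro _ ⟨n, rfl⟩
      exact Set.mem_ofPred.2 (hk n ▸ bridgeVertex_mem_range e 0 n)

end Counterexample


/-- There exists a locally finite connected graph `G` such that every rooted
tree-decomposition of `G` in which every end `ω` gives rise to a rooted ray `R_ω` with
`liminf_{e∈E(R_ω)} V_e = ∅` and `liminf_{e∈E(R_ω)} |V_e| = deg(ω)` is not strongly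
linked. -/
theorem statement_9 :
    ∃ G : SimpleGraph ℕ, LocFin G ∧ G.Connected ∧
      ∀ (M : Type v) (T : SimpleGraph M) (D : RootedTreeDecomp G T),
        (∀ r : ℕ → ℕ, IsRay G r → ∃ ρ : ℕ → M, D.GivesRise r ρ ∧
          D.bagLiminf ρ = ∅ ∧ D.adhLiminf ρ = EndDegree G r) →
        ¬ D.toTreeDecomp.StronglyLinked := by
  obtain ⟨e⟩ := Blob.nonempty_equiv
  exact ⟨blobGraph e, locFin_blobGraph e, connected_blobGraph e, fun _ _ _ hD =>
    (columnEnds e).not_stronglyLinked hD⟩
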